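/- Let n ≥ 2 and m ≥ 1 be integers and let c be a positive integer with c ≥ n·(2 + ln(1 + m/n)). Then X_S(n,c) := max{X_{(1),n}, Z_{(1),c}} stochastically dominates X_L(n,m); that is, for every p ∈ [0,1], Pr[max{X_{(1),n}, Z_{(1),c}} > p] ≥ Pr[X_L(n,m) > p]. -/

import Mathlib

open MeasureTheory Set

/-- The uniform distribution on `[0,1]`. -/
noncomputable def unif : Measure ℝ := volume.restrict (Set.Icc 0 1)

instance : IsProbabilityMeasure unif := by
  constructor
  simp [unif, Real.volume_Icc]

/-- The `k`-th largest entry (1-indexed) of a tuple `x : Fin n → ℝ`. -/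
noncomputable def kthLargest {n : ℕ} (x : Fin n → ℝ) (k : ℕ) : ℝ :=
  if h : n - k < n then x (Tuple.sort x ⟨n - k, h⟩) else 0

open Classical in
/-- Using an auxiliary uniform `v ∈ [0,1]` as randomness, pick (uniformly at random when `v`
is uniform) the value `y j` for an index `j` in the set `{j | t < y j}`.  Returns `0` if
that set is empty. -/
noncomputable def pickedY {k : ℕ} (y : Fin k → ℝ) (t v : ℝ) : ℝ :=
  let S : Finset (Fin k) := Finset.univ.filter (fun j => t < y j)
  ((S.sort (· ≤ ·)).map y).getD (min (Int.toNat ⌊v * S.card⌋) (S.card - 1)) 0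

open Classical in
/-- The random variable `X_L(n,m)`: here `x` are the `n` i.i.d. uniform draws,
`u ∈ [0,1]` is the auxiliary uniform defining `W_{2,n}` (uniform on `[X_{(2),n},1]`),
`y` are the `m-1` i.i.d. uniform draws `Y_1,…,Y_{m-1}`, and `v ∈ [0,1]` is the auxiliary
uniform used to choose `J` uniformly from `{j | Y_j > X_{(1),n}}`. -/
noncomputable def XL {n k : ℕ} (x : Fin n → ℝ) (u : ℝ) (y : Fin k → ℝ) (v : ℝ) : ℝ :=
  let X1 := kthLargest x 1
  let w := kthLargest x 2 + u * (1 - kthLargest x 2)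
  if ∀ j, y j < X1 then max X1 w else max (pickedY y X1 v) w

/-- The sample space: `n` i.i.d. uniforms `X`, the auxiliary uniform for `W_{2,n}`,
`c` i.i.d. uniforms `Z`, `m-1` i.i.d. uniforms `Y`, and the auxiliary uniform for `J`,
all independent. -/
noncomputable def P₁ (n c m : ℕ) :
    Measure ((Fin n → ℝ) × ℝ × (Fin c → ℝ) × (Fin (m - 1) → ℝ) × ℝ) :=
  (Measure.pi fun _ : Fin n => unif).prod
    (unif.prod ((Measure.pi fun _ : Fin c => unif).prod
      ((Measure.pi fun _ : Fin (m - 1) => unif).prod unif)))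

open Finset in
lemma kth_one_le {n : ℕ} (hn : 1 ≤ n) (x : Fin n → ℝ) :
    (∀ i, x i ≤ kthLargest x 1) ∧ ∃ j, kthLargest x 1 = x j := by
  have h : n - 1 < n := by omega
  constructor
  · intro i
    rw [kthLargest, dif_pos h]
    have := Tuple.monotone_sort x (a := (Tuple.sort x).symm i) (b := ⟨n-1, h⟩)
      (by rw [Fin.le_def]; have := ((Tuple.sort x).symm i).2; simp only; omega)
    simpa using this
  · rw [kthLargest, dif_pos h]; exact ⟨_, rfl⟩

lemma kth_two {n : ℕ} (hn : 2 ≤ n) (x : Fin n → ℝ) :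
    ∃ i j, i ≠ j ∧ kthLargest x 2 = x j ∧ x j ≤ x i ∧ ∀ l, l ≠ i → x l ≤ x j := by
  have h : n - 2 < n := by omega
  have h1 : n - 1 < n := by omega
  refine ⟨Tuple.sort x ⟨n-1, h1⟩, Tuple.sort x ⟨n-2, h⟩, ?_, ?_, ?_, ?_⟩
  · intro hh
    have := (Tuple.sort x).injective hh
    simp only [Fin.mk.injEq] at this
    omega
  · rw [kthLargest, dif_pos h]
  · exact Tuple.monotone_sort x (by rw [Fin.le_def]; simp only; omega)
  · intro l hl
    have h3 : (Tuple.sort x).symm l ≠ ⟨n-1, h1⟩ := by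
      intro hh; apply hl; rw [← hh]; simp
    have h4 : ((Tuple.sort x).symm l).1 ≠ n - 1 := fun hh => h3 (Fin.ext hh)
    have := Tuple.monotone_sort x (a := (Tuple.sort x).symm l) (b := ⟨n-2, h⟩)
      (by rw [Fin.le_def]; have := ((Tuple.sort x).symm l).2; simp only; omega)
    simpa using this

lemma meas_kth {n : ℕ} (k : ℕ) : Measurable (fun x : Fin n → ℝ => kthLargest x k) := by
  unfold kthLargest
  by_cases h : n - k < n
  · simp only [dif_pos h]
    have hm : ∀ σ : Equiv.Perm (Fin n), MeasurableSet {x : Fin n → ℝ | Tuple.sort x = σ} := by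
      intro σ
      have : {x : Fin n → ℝ | Tuple.sort x = σ} =
          (⋂ i, ⋂ j, ⋂ (_ : i ≤ j), {x | x (σ i) ≤ x (σ j)}) ∩
            ⋂ i, ⋂ j, ⋂ (_ : i < j), {x | x (σ i) = x (σ j) → σ i < σ j} := by
        ext x
        simp only [mem_ofPred_eq, mem_inter_iff, mem_iInter]
        rw [eq_comm, Tuple.eq_sort_iff]
        rfl
      rw [this]
      refine MeasurableSet.inter ?_ ?_
      · refine MeasurableSet.iInter fun i => MeasurableSet.iInter fun j => MeasurableSet.iInter fun _ => ?_
        exact measurableSet_le (measurable_pi_apply _) (measurable_pi_apply _)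
      · refine MeasurableSet.iInter fun i => MeasurableSet.iInter fun j => MeasurableSet.iInter fun _ => ?_
        by_cases hs : σ i < σ j
        · simp [hs]
        · simp only [hs, imp_false]
          exact (measurableSet_eq_fun (f := fun x : Fin n → ℝ => x (σ i)) (g := fun x : Fin n → ℝ => x (σ j)) (by fun_prop) (by fun_prop)).compl
    intro s hs
    have : (fun x : Fin n → ℝ => x (Tuple.sort x ⟨n - k, h⟩)) ⁻¹' s =
        ⋃ σ : Equiv.Perm (Fin n), {x | Tuple.sort x = σ} ∩ {x | x (σ ⟨n-k, h⟩) ∈ s} := by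
      ext x; simp
    rw [this]
    exact MeasurableSet.iUnion fun σ => (hm σ).inter (measurable_pi_apply _ hs)
  · simp only [dif_neg h]; exact measurable_const

/-- the (0-indexed) position used by `pickedY` -/
noncomputable def pos (s : ℕ) (v : ℝ) : ℕ := min (Int.toNat ⌊v * s⌋) (s - 1)

lemma picked_idx {k : ℕ} (A : Finset (Fin k)) (hA : A.Nonempty) (N : ℕ) :
    ∃ j ∈ A, ∀ y : Fin k → ℝ, ((A.sort (· ≤ ·)).map y).getD (min N (A.card - 1)) 0 = y j := by
  have hc : 0 < A.card := hA.card_pos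
  have hl : min N (A.card - 1) < (A.sort (· ≤ ·)).length := by
    rw [Finset.length_sort]; omega
  refine ⟨(A.sort (· ≤ ·))[min N (A.card - 1)], ?_, ?_⟩
  · rw [← Finset.mem_sort (· ≤ ·)]; exact List.getElem_mem _
  · intro y
    rw [List.getD_eq_getElem _ _ (by simpa using hl)]
    simp

open Classical in
lemma meas_picked {k : ℕ} :
    Measurable (fun z : ℝ × (Fin k → ℝ) × ℝ => pickedY z.2.1 z.1 z.2.2) := by
  have hA : ∀ A : Finset (Fin k), MeasurableSet {z : ℝ × (Fin k → ℝ) × ℝ |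
      Finset.univ.filter (fun j => z.1 < z.2.1 j) = A} := by
    intro A
    have : {z : ℝ × (Fin k → ℝ) × ℝ | Finset.univ.filter (fun j => z.1 < z.2.1 j) = A} =
        ⋂ j, {z | z.1 < z.2.1 j ↔ j ∈ A} := by
      ext z; simp [Finset.ext_iff]
    rw [this]
    refine MeasurableSet.iInter fun j => ?_
    have hm : MeasurableSet {z : ℝ × (Fin k → ℝ) × ℝ | z.1 < z.2.1 j} :=
      measurableSet_lt (by fun_prop) (by fun_prop)
    by_cases hj : j ∈ A
    · simpa [hj] using hm
    · simp only [hj, iff_false]; exact hm.compl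
  intro s hs
  have : (fun z : ℝ × (Fin k → ℝ) × ℝ => pickedY z.2.1 z.1 z.2.2) ⁻¹' s =
      ⋃ A : Finset (Fin k), ⋃ N : ℕ,
        ({z | Finset.univ.filter (fun j => z.1 < z.2.1 j) = A} ∩
        {z | (Int.toNat ⌊z.2.2 * (A.card : ℝ)⌋) = N}) ∩
        {z | ((A.sort (· ≤ ·)).map z.2.1).getD (min N (A.card - 1)) 0 ∈ s} := by
    ext z
    simp [pickedY]
  rw [this]
  refine MeasurableSet.iUnion fun A => MeasurableSet.iUnion fun N => ?_
  refine ((hA A).inter ?_).inter ?_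
  · have h1 : Measurable (fun z : ℝ × (Fin k → ℝ) × ℝ => ⌊z.2.2 * (A.card : ℝ)⌋) :=
      Int.measurable_floor.comp (by fun_prop)
    exact h1 (MeasurableSet.of_discrete (s := {i : ℤ | i.toNat = N}))
  · rcases A.eq_empty_or_nonempty with rfl | hne
    · simp
    · obtain ⟨j, -, hj⟩ := picked_idx A hne N
      simp only [hj]
      exact (show Measurable (fun z : ℝ × (Fin k → ℝ) × ℝ => z.2.1 j) by fun_prop) hs

lemma unif_Iic {t : ℝ} (h0 : 0 ≤ t) (h1 : t ≤ 1) : unif (Iic t) = ENNReal.ofReal t := by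
  rw [unif, Measure.restrict_apply measurableSet_Iic]
  have : Iic t ∩ Icc 0 1 = Icc 0 t := by
    ext a; simp only [mem_inter_iff, mem_Iic, mem_Icc]
    constructor
    · rintro ⟨a, b, c⟩; exact ⟨b, a⟩
    · rintro ⟨a, b⟩; exact ⟨b, a, b.trans h1⟩
  rw [this, Real.volume_Icc, sub_zero]

lemma unif_Ioi {t : ℝ} (h0 : 0 ≤ t) : unif (Ioi t) = ENNReal.ofReal (1 - t) := by
  rw [unif, Measure.restrict_apply measurableSet_Ioi]
  have : Ioi t ∩ Icc 0 1 = Ioc t 1 := by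
    ext a; simp only [mem_inter_iff, mem_Ioi, mem_Icc, mem_Ioc]
    constructor
    · rintro ⟨a, b, c⟩; exact ⟨a, c⟩
    · rintro ⟨a, b⟩; exact ⟨a, h0.trans a.le, b⟩
  rw [this, Real.volume_Ioc]

lemma unif_W {s p : ℝ} (hs : 0 ≤ s) (hsp : s < p) (hp : p < 1) :
    ENNReal.ofReal ((p - s) / (1 - s)) ≤ unif {u | s + u * (1 - s) ≤ p} := by
  have h1 : (0:ℝ) < 1 - s := by linarith
  have : {u | s + u * (1 - s) ≤ p} = Iic ((p - s) / (1 - s)) := by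
    ext u; simp only [mem_ofPred_eq, mem_Iic]; rw [le_div_iff₀ h1]
    constructor <;> intro h <;> linarith
  rw [this, unif_Iic (div_nonneg (by linarith) h1.le)]
  rw [div_le_one h1]; linarith

open Classical in
lemma picked_meas_A {k : ℕ} {t p : ℝ} (v : ℝ) (h0 : 0 ≤ t) (htp : t ≤ p) (hp0 : 0 ≤ p) (hp : p < 1)
    (A : Finset (Fin k)) :
    (Measure.pi fun _ : Fin k => unif)
      {y | Finset.univ.filter (fun j => t < y j) = A ∧ p < pickedY y t v} ≤
      ENNReal.ofReal (if A.Nonempty then (1 - p) * ((1 - t) ^ (A.card - 1) * t ^ (k - A.card)) else 0) := by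
  by_cases hA : A.Nonempty
  · obtain ⟨j, hjA, hj⟩ := picked_idx A hA (Int.toNat ⌊v * A.card⌋)
    have hsub : {y : Fin k → ℝ | Finset.univ.filter (fun j => t < y j) = A ∧ p < pickedY y t v} ⊆
        univ.pi (fun i => if i ∈ A then (if i = j then Ioi p else Ioi t) else Iic t) := by
      rintro y ⟨hy, hpy⟩ i -
      simp only [pickedY, hy, hj] at hpy
      have hi : t < y i ↔ i ∈ A := by rw [← hy]; simp
      by_cases hiA : i ∈ A
      · simp only [hiA, if_true]
        split_ifs with h
        · rw [h]; exact hpy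
        · exact hi.2 hiA
      · simp only [hiA, if_false]
        exact not_lt.1 (fun h => hiA (hi.1 h))
    refine (measure_mono hsub).trans ?_
    rw [Measure.pi_pi, if_pos hA]
    have : ∀ i, unif (if i ∈ A then (if i = j then Ioi p else Ioi t) else Iic t) =
        ENNReal.ofReal (if i ∈ A then (if i = j then 1 - p else 1 - t) else t) := by
      intro i
      split_ifs
      · exact unif_Ioi hp0
      · exact unif_Ioi h0
      · exact unif_Iic h0 (by linarith)
    simp only [this]
    rw [← ENNReal.ofReal_prod_of_nonneg]
    · apply ENNReal.ofReal_le_ofReal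
      rw [Finset.prod_ite]
      have e1 : Finset.univ.filter (fun i => i ∈ A) = A := by ext; simp
      have e2 : (Finset.univ.filter (fun i => i ∉ A)).card = k - A.card := by
        have := Finset.card_compl A
        rw [Fintype.card_fin] at this
        rw [← this]; congr 1; ext; simp
      rw [e1, Finset.prod_const, e2, ← Finset.mul_prod_erase A _ hjA, if_pos rfl]
      rw [Finset.prod_congr rfl (g := fun _ => 1 - t)]
      · rw [Finset.prod_const, Finset.card_erase_of_mem hjA, mul_assoc]
      · intro i hi
        rw [if_neg (Finset.ne_of_mem_erase hi)]
    · intro i _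
      split_ifs <;> linarith
  · rw [if_neg hA]
    rw [Finset.not_nonempty_iff_eq_empty] at hA
    subst hA
    have : {y : Fin k → ℝ | Finset.univ.filter (fun j => t < y j) = ∅ ∧ p < pickedY y t v} = ∅ := by
      ext y
      simp only [mem_ofPred_eq, mem_empty_iff_false, iff_false, not_and, not_lt]
      intro hy
      simp only [pickedY, hy]
      simpa using hp0
    rw [this]; simp

open Classical in
lemma picked_meas {k : ℕ} {t p : ℝ} (v : ℝ) (h0 : 0 ≤ t) (htp : t ≤ p) (hp : p < 1) :
    (Measure.pi fun _ : Fin k => unif) {y | p < pickedY y t v} ≤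
      ENNReal.ofReal ((1 - p) * ∑ i ∈ Finset.range k, t ^ i) := by
  have hsub : {y : Fin k → ℝ | p < pickedY y t v} ⊆ ⋃ A ∈ (Finset.univ : Finset (Finset (Fin k))),
      {y | Finset.univ.filter (fun j => t < y j) = A ∧ p < pickedY y t v} := by
    intro y hy; simpa using hy
  refine (measure_mono hsub).trans ((measure_biUnion_finset_le _ _).trans ?_)
  refine (Finset.sum_le_sum fun A _ => picked_meas_A v h0 htp (h0.trans htp) hp A).trans ?_
  have h1t : 0 < 1 - t := by linarith
  rw [← ENNReal.ofReal_sum_of_nonneg]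
  · apply ENNReal.ofReal_le_ofReal
    apply le_of_eq
    rw [← mul_left_inj' h1t.ne', mul_assoc (1-p), geom_sum_mul_neg, Finset.sum_mul]
    have key := Finset.sum_pow_mul_eq_add_pow (1 - t) t (Finset.univ : Finset (Fin k))
    simp only [Finset.powerset_univ, Finset.card_univ, Fintype.card_fin, sub_add_cancel, one_pow] at key
    rw [← Finset.add_sum_erase _ _ (Finset.mem_univ (∅ : Finset (Fin k)))] at key ⊢
    simp only [Finset.card_empty, pow_zero, Nat.sub_zero, one_mul] at key
    have : ∑ x ∈ Finset.univ.erase (∅ : Finset (Fin k)),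
        (if x.Nonempty then (1 - p) * ((1 - t) ^ (x.card - 1) * t ^ (k - x.card)) else 0) * (1 - t)
        = (1 - p) * ∑ x ∈ Finset.univ.erase (∅ : Finset (Fin k)), (1 - t) ^ x.card * t ^ (k - x.card) := by
      rw [Finset.mul_sum]
      refine Finset.sum_congr rfl fun A hA => ?_
      have hne : A.Nonempty := Finset.nonempty_iff_ne_empty.2 (Finset.ne_of_mem_erase hA)
      rw [if_pos hne]
      obtain ⟨r, hr⟩ : ∃ r, A.card = r + 1 := ⟨A.card - 1, by have := hne.card_pos; omega⟩
      rw [hr, Nat.add_sub_cancel, pow_succ]; ring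
    rw [this]
    simp only [Finset.not_nonempty_empty, if_false, zero_mul, zero_add]
    congr 1
    linarith
  · intro A _
    split_ifs
    · have : 0 ≤ 1 - p := by linarith
      positivity
    · exact le_rfl

/-- lower bound on the second factor -/
lemma g_bound {p R : ℝ} (hp0 : 0 < p) (hp : p < 1) (hR0 : 0 ≤ R) (hR : R ≤ 1) (k : ℕ) :
    p ^ k ≤ 1 - (1 - p) * ∑ i ∈ Finset.range k, (p * R) ^ i ∧
    p ^ (∑ i ∈ Finset.range k, R ^ i) ≤ 1 - (1 - p) * ∑ i ∈ Finset.range k, (p * R) ^ i := by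
  have h1 : ∀ k : ℕ, p ^ k ≤ 1 - (1 - p) * ∑ i ∈ Finset.range k, (p * R) ^ i := by
    intro k
    have h2 : ∑ i ∈ Finset.range k, (p * R) ^ i ≤ ∑ i ∈ Finset.range k, p ^ i := by
      refine Finset.sum_le_sum fun i _ => ?_
      exact pow_le_pow_left₀ (by positivity) (by nlinarith) i
    have h3 := geom_sum_mul_neg p k
    nlinarith
  refine ⟨h1 k, ?_⟩
  induction k with
  | zero => simp
  | succ k ih =>
    rw [Finset.sum_range_succ, Finset.sum_range_succ, Real.rpow_add hp0]
    have hRk0 : 0 ≤ R ^ k := by positivity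
    have hRk1 : R ^ k ≤ 1 := pow_le_one₀ hR0 hR
    have hb : p ^ (R ^ k) ≤ 1 - (1 - p) * R ^ k := by
      have := rpow_one_add_le_one_add_mul_self (s := p - 1) (by linarith) hRk0 hRk1
      rw [show 1 + (p - 1) = p by ring] at this
      linarith
    have h4 := h1 k
    set G := 1 - (1 - p) * ∑ i ∈ Finset.range k, (p * R) ^ i
    have h5 : 0 ≤ p ^ (∑ i ∈ Finset.range k, R ^ i) := Real.rpow_nonneg hp0.le _
    have h6 : 0 ≤ p ^ (R ^ k) := Real.rpow_nonneg hp0.le _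
    have hG : 0 ≤ G := h5.trans ih
    calc p ^ (∑ i ∈ Finset.range k, R ^ i) * p ^ (R ^ k) ≤ G * (1 - (1 - p) * R ^ k) :=
          mul_le_mul ih hb h6 hG
      _ ≤ G - (1 - p) * (p * R) ^ k := by
          rw [mul_pow]
          have : 0 ≤ ((1 - p) * R ^ k) * (G - p ^ k) :=
            mul_nonneg (mul_nonneg (by linarith) hRk0) (by linarith)
          nlinarith
      _ = _ := by simp only [G]; ring

lemma f_bound {p s : ℝ} (hp0 : 0 < p) (hp : p < 1) (hs : 0 ≤ s) (hsp : s < p) :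
    p ^ (p / (p - s)) ≤ (p - s) / (1 - s) := by
  have h1 : 0 < p - s := by linarith
  have h2 : 0 < 1 - s := by linarith
  have h3 : p / (p - s) = 1 + s / (p - s) := by field_simp; ring
  have h4 : p ^ (s / (p - s)) ≤ (p - s) / (p * (1 - s)) := by
    rw [← Real.log_le_log_iff (Real.rpow_pos_of_pos hp0 _) (by positivity), Real.log_rpow hp0]
    have h5 : Real.log p ≤ p - 1 := Real.log_le_sub_one_of_pos hp0
    have h6 := Real.one_sub_inv_le_log_of_pos (x := (p - s) / (p * (1 - s))) (by positivity)
    refine le_trans ?_ h6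
    have h7 : 0 ≤ s / (p - s) := by positivity
    calc s / (p - s) * Real.log p ≤ s / (p - s) * (p - 1) := mul_le_mul_of_nonneg_left h5 h7
      _ = _ := by field_simp; ring
  rw [h3, Real.rpow_add hp0, Real.rpow_one]
  calc p * p ^ (s / (p - s)) ≤ p * ((p - s) / (p * (1 - s))) := mul_le_mul_of_nonneg_left h4 hp0.le
    _ = _ := by field_simp

lemma harm_bound (n : ℕ) (hn : 1 ≤ n) (K : ℕ) :
    ∑ k ∈ Finset.range K, (1 : ℝ) / (n + k) ≤ 1 / n - 1 / (n + K) + Real.log ((n + K) / n) := by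
  have hn' : (0:ℝ) < n := by exact_mod_cast hn
  induction K with
  | zero => simp [hn'.ne']
  | succ K ih =>
    rw [Finset.sum_range_succ]
    have hN : (0:ℝ) < n + K := by positivity
    push_cast
    have h1 := Real.one_sub_inv_le_log_of_pos (x := ((n:ℝ) + (K + 1)) / (n + K)) (by positivity)
    have h2 : Real.log (((n:ℝ) + (K + 1)) / n) =
        Real.log (((n:ℝ) + (K + 1)) / (n + K)) + Real.log ((n + K) / n) := by
      rw [← Real.log_mul (by positivity) (by positivity)]; congr 1; field_simp
    rw [h2]
    have h3 : 1 - (((n:ℝ) + (K + 1)) / (n + K))⁻¹ = 1 / (n + (K + 1)) := by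
      field_simp; ring
    linarith

lemma const_bound (n m c : ℕ) (hn : 2 ≤ n) (hm : 1 ≤ m)
    (hcb : (n : ℝ) * (2 + Real.log (1 + (m : ℝ) / (n : ℝ))) ≤ (c : ℝ)) :
    (n : ℝ) + ∑ k ∈ Finset.range (m - 1), (n : ℝ) / (n + k) ≤ c := by
  have hn' : (2:ℝ) ≤ n := by exact_mod_cast hn
  have h := harm_bound n (by omega) (m - 1)
  have hK : (((m - 1 : ℕ) : ℝ)) ≤ m := by exact_mod_cast Nat.sub_le _ _
  have h1 : ∑ k ∈ Finset.range (m - 1), (n : ℝ) / (n + k) =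
      n * ∑ k ∈ Finset.range (m - 1), (1 : ℝ) / (n + k) := by
    rw [Finset.mul_sum]; refine Finset.sum_congr rfl fun _ _ => by ring
  have h2 : Real.log (((n:ℝ) + (m - 1 : ℕ)) / n) ≤ Real.log (1 + (m : ℝ) / (n : ℝ)) := by
    apply Real.log_le_log (by positivity)
    rw [add_div, div_self (by positivity)]
    gcongr
  have h3 : (1:ℝ) / n ≤ 1 := by rw [div_le_one (by positivity)]; linarith
  have h4 : (0:ℝ) ≤ 1 / (n + (m - 1 : ℕ)) := by positivity
  rw [h1]
  have : (n:ℝ) * ∑ k ∈ Finset.range (m - 1), (1 : ℝ) / (n + k) ≤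
      n * (1 + Real.log (1 + (m : ℝ) / (n : ℝ))) :=
    mul_le_mul_of_nonneg_left (by linarith) (by positivity)
  linarith
lemma lint_coord {n : ℕ} (ν : Measure ℝ) [SigmaFinite ν] (j : Fin (n+1)) (φ : ℝ → ENNReal)
    (hφ : Measurable φ) (B : Fin n → ℝ → Set ℝ)
    (hB : MeasurableSet {z : ℝ × (Fin n → ℝ) | ∀ i, z.2 i ∈ B i z.1}) :
    ∫⁻ x, φ (x j) * ({x : Fin (n+1) → ℝ | ∀ i, x (j.succAbove i) ∈ B i (x j)}.indicator 1 x)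
      ∂(Measure.pi fun _ => ν) = ∫⁻ a, φ a * ∏ i, ν (B i a) ∂ν := by
  have hmp := measurePreserving_piFinSuccAbove (fun _ : Fin (n+1) => ν) j
  have hF : Measurable (fun z : ℝ × (Fin n → ℝ) =>
      φ z.1 * ({z : ℝ × (Fin n → ℝ) | ∀ i, z.2 i ∈ B i z.1}.indicator 1 z)) :=
    (hφ.comp measurable_fst).mul (measurable_one.indicator hB)
  have h1 := hmp.lintegral_comp hF
  refine Eq.trans ?_ (h1.trans ?_)
  · rfl
  · rw [lintegral_prod _ hF.aemeasurable]
    refine lintegral_congr fun a => ?_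
    have hs : {y : Fin n → ℝ | ∀ i, y i ∈ B i a} = univ.pi (fun i => B i a) := by
      ext y; simp
    have hms : MeasurableSet {y : Fin n → ℝ | ∀ i, y i ∈ B i a} :=
      (measurable_prodMk_left (x := a)) hB
    have : ∀ y : Fin n → ℝ, {z : ℝ × (Fin n → ℝ) | ∀ i, z.2 i ∈ B i z.1}.indicator
        (1 : ℝ × (Fin n → ℝ) → ENNReal) (a, y) = {y : Fin n → ℝ | ∀ i, y i ∈ B i a}.indicator 1 y := by
      intro y; rfl
    simp only [this]
    rw [lintegral_const_mul _ (measurable_one.indicator hms), lintegral_indicator_one hms, hs,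
      Measure.pi_pi]

/-- Lebesgue measure on `[0,p)`. -/
noncomputable def nu (p : ℝ) : Measure ℝ := volume.restrict (Ico 0 p)

instance (p : ℝ) : IsFiniteMeasure (nu p) := by
  constructor; simp [nu]

lemma nu_Iic {p a : ℝ} (ha : a ∈ Ico 0 p) : nu p (Iic a) = ENNReal.ofReal a := by
  rw [nu, Measure.restrict_apply measurableSet_Iic]
  have : Iic a ∩ Ico 0 p = Icc 0 a := by
    ext b; simp only [mem_inter_iff, mem_Iic, mem_Icc, mem_Ico]
    constructor
    · rintro ⟨h, h', _⟩; exact ⟨h', h⟩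
    · rintro ⟨h, h'⟩; exact ⟨h', h, h'.trans_lt ha.2⟩
  rw [this, Real.volume_Icc, sub_zero]

lemma nu_Ici {p a : ℝ} (ha : a ∈ Ico 0 p) : nu p (Ici a) = ENNReal.ofReal (p - a) := by
  rw [nu, Measure.restrict_apply measurableSet_Ici]
  have : Ici a ∩ Ico 0 p = Ico a p := by
    ext b; simp only [mem_inter_iff, mem_Ici, mem_Ico]
    constructor
    · rintro ⟨h, h', h2⟩; exact ⟨h, h2⟩
    · rintro ⟨h, h'⟩; exact ⟨h, ha.1.trans h, h'⟩
  rw [this, Real.volume_Ico]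

lemma nu_pow {p : ℝ} (hp : 0 < p) (r : ℕ) :
    ∫⁻ a, ENNReal.ofReal (a ^ r) ∂(nu p) = ENNReal.ofReal (p ^ (r + 1) / (r + 1)) := by
  have h1 : ∫ a in (0:ℝ)..p, a ^ r = p ^ (r + 1) / (r + 1) := by
    rw [integral_pow]; simp
  rw [intervalIntegral.integral_of_le hp.le] at h1
  rw [nu, Measure.restrict_congr_set Ico_ae_eq_Ioc, ← h1, ofReal_integral_eq_lintegral_ofReal]
  · exact (intervalIntegrable_iff_integrableOn_Ioc_of_le hp.le).1 ((continuous_pow r).intervalIntegrable _ _)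
  · filter_upwards [ae_restrict_mem measurableSet_Ioc] with a ha
    exact pow_nonneg ha.1.le r

lemma nu_mem (p : ℝ) : ∀ᵐ a ∂(nu p), a ∈ Ico 0 p := ae_restrict_mem measurableSet_Ico

lemma pi_nu_mem (n : ℕ) (p : ℝ) : ∀ᵐ x ∂(Measure.pi fun _ : Fin n => nu p), ∀ i, x i ∈ Ico 0 p := by
  rw [ae_all_iff]
  intro i
  exact (Measure.quasiMeasurePreserving_eval (μ := fun _ : Fin n => nu p) i).ae (nu_mem p)

lemma max_moment {n : ℕ} {p : ℝ} (hp : 0 < p) (k : ℕ) :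
    ∫⁻ x, ENNReal.ofReal ((kthLargest x 1 / p) ^ k) ∂(Measure.pi fun _ : Fin (n+1) => nu p) ≤
      ENNReal.ofReal (p ^ (n+1) * ((n + 1 : ℕ) / ((n + 1 : ℕ) + k))) := by
  have hB : MeasurableSet {z : ℝ × (Fin n → ℝ) | ∀ i, z.2 i ∈ (fun (_ : Fin n) (a : ℝ) => Iic a) i z.1} := by
    have : {z : ℝ × (Fin n → ℝ) | ∀ i, z.2 i ∈ (fun (_ : Fin n) (a : ℝ) => Iic a) i z.1} =
        ⋂ i, {z | z.2 i ≤ z.1} := by ext z; simp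
    rw [this]
    exact MeasurableSet.iInter fun i => measurableSet_le (by fun_prop) (by fun_prop)
  have hφ : Measurable (fun a : ℝ => ENNReal.ofReal ((a / p) ^ k)) := by fun_prop
  calc _ ≤ ∫⁻ x, ∑ j : Fin (n+1), ENNReal.ofReal ((x j / p) ^ k) *
        ({x : Fin (n+1) → ℝ | ∀ i, x (j.succAbove i) ∈ Iic (x j)}.indicator 1 x)
        ∂(Measure.pi fun _ : Fin (n+1) => nu p) := by
        refine lintegral_mono fun x => ?_
        obtain ⟨h1, j, hj⟩ := kth_one_le (by omega) x
        simp only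
        refine le_trans ?_ (Finset.single_le_sum (fun _ _ => zero_le) (Finset.mem_univ j))
        rw [indicator_of_mem, Pi.one_apply, mul_one, hj]
        intro i; simp only [mem_Iic]; rw [← hj]; exact h1 _
    _ = ∑ j : Fin (n+1), ∫⁻ a, ENNReal.ofReal ((a / p) ^ k) * ∏ _i : Fin n, nu p (Iic a) ∂(nu p) := by
        rw [lintegral_finsetSum']
        · refine Finset.sum_congr rfl fun j _ => ?_
          exact lint_coord (nu p) j _ hφ (fun _ a => Iic a) hB
        · intro j _
          have hm : Measurable (fun x : Fin (n+1) → ℝ => (x j, fun i => x (j.succAbove i))) := by fun_prop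
          exact ((hφ.comp (measurable_pi_apply j)).mul
            (measurable_one.indicator (hm hB))).aemeasurable
    _ = ∑ j : Fin (n+1), ENNReal.ofReal (1 / p ^ k) * ENNReal.ofReal (p ^ (k + n + 1) / ((k + n : ℕ) + 1)) := by
        refine Finset.sum_congr rfl fun j _ => ?_
        rw [← nu_pow hp, ← lintegral_const_mul _ (by fun_prop)]
        refine lintegral_congr_ae ?_
        filter_upwards [nu_mem p] with a ha
        have ha0 := ha.1
        rw [Finset.prod_const, nu_Iic ha, Finset.card_univ, Fintype.card_fin,
          ← ENNReal.ofReal_pow ha0, ← ENNReal.ofReal_mul (by positivity),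
          ← ENNReal.ofReal_mul (by positivity)]
        congr 1
        rw [div_pow, pow_add]; ring
    _ ≤ _ := by
        rw [Finset.sum_const, Finset.card_univ, Fintype.card_fin, nsmul_eq_mul,
          ← ENNReal.ofReal_mul (by positivity), ← ENNReal.ofReal_natCast,
          ← ENNReal.ofReal_mul (by positivity)]
        apply ENNReal.ofReal_le_ofReal
        apply le_of_eq
        push_cast
        rw [add_assoc k n 1, pow_add]
        field_simp
        ring

lemma second_moment {N : ℕ} {p : ℝ} (hp : 0 < p) :
    ∫⁻ x, ENNReal.ofReal (p / (p - kthLargest x 2)) ∂(Measure.pi fun _ : Fin (N+2) => nu p) ≤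
      ENNReal.ofReal (p ^ (N+2) * ((N + 2 : ℕ))) := by
  let B : Fin (N+1) → Fin (N+1) → ℝ → Set ℝ := fun i' i a => if i = i' then Ici a else Iic a
  have hB : ∀ i', MeasurableSet {z : ℝ × (Fin (N+1) → ℝ) | ∀ i, z.2 i ∈ B i' i z.1} := by
    intro i'
    have : {z : ℝ × (Fin (N+1) → ℝ) | ∀ i, z.2 i ∈ B i' i z.1} =
        ⋂ i, if i = i' then {z | z.1 ≤ z.2 i} else {z | z.2 i ≤ z.1} := by
      ext z; simp only [mem_ofPred_eq, mem_iInter, B]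
      refine forall_congr' fun i => ?_
      split_ifs <;> simp
    rw [this]
    refine MeasurableSet.iInter fun i => ?_
    split_ifs
    · exact measurableSet_le (by fun_prop) (by fun_prop)
    · exact measurableSet_le (by fun_prop) (by fun_prop)
  have hφ : Measurable (fun a : ℝ => ENNReal.ofReal (p / (p - a))) := by fun_prop
  have hm : ∀ j : Fin (N+2), ∀ i' : Fin (N+1), Measurable (fun x : Fin (N+2) → ℝ => 
      ENNReal.ofReal (p / (p - x j)) *
        ({x : Fin (N+2) → ℝ | ∀ i, x (j.succAbove i) ∈ B i' i (x j)}.indicator 1 x)) := by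
    intro j i'
    have hm : Measurable (fun x : Fin (N+2) → ℝ => (x j, fun i => x (j.succAbove i))) := by fun_prop
    exact ((hφ.comp (measurable_pi_apply j)).mul (measurable_one.indicator (hm (hB i'))))
  calc _ ≤ ∫⁻ x, ∑ j : Fin (N+2), ∑ i' : Fin (N+1), ENNReal.ofReal (p / (p - x j)) *
        ({x : Fin (N+2) → ℝ | ∀ i, x (j.succAbove i) ∈ B i' i (x j)}.indicator 1 x)
        ∂(Measure.pi fun _ : Fin (N+2) => nu p) := by
        refine lintegral_mono fun x => ?_
        obtain ⟨i, j, hij, hj, hle, hall⟩ := kth_two (by omega) x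
        obtain ⟨i', rfl⟩ := Fin.exists_succAbove_eq hij
        simp only
        refine le_trans ?_ (Finset.single_le_sum (fun _ _ => zero_le) (Finset.mem_univ j))
        refine le_trans ?_ (Finset.single_le_sum (fun _ _ => zero_le) (Finset.mem_univ i'))
        rw [indicator_of_mem, Pi.one_apply, mul_one, hj]
        intro i
        simp only [B]
        split_ifs with h
        · rw [h]; exact hle
        · exact hall _ (fun hh => h (Fin.succAbove_right_injective hh))
    _ = ∑ j : Fin (N+2), ∑ i' : Fin (N+1), ∫⁻ a, ENNReal.ofReal (p / (p - a)) *
          ∏ i : Fin (N+1), nu p (B i' i a) ∂(nu p) := by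
        rw [lintegral_finsetSum']
        · refine Finset.sum_congr rfl fun j _ => ?_
          rw [lintegral_finsetSum']
          · refine Finset.sum_congr rfl fun i' _ => ?_
            exact lint_coord (nu p) j _ hφ (B i') (hB i')
          · intro i' _; exact (hm j i').aemeasurable
        · intro j _
          exact (Finset.measurable_sum _ fun i' _ => hm j i').aemeasurable
    _ = ∑ j : Fin (N+2), ∑ i' : Fin (N+1),
          ENNReal.ofReal p * ENNReal.ofReal (p ^ (N + 1) / (N + 1)) := by
        refine Finset.sum_congr rfl fun j _ => Finset.sum_congr rfl fun i' _ => ?_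
        rw [← nu_pow hp, ← lintegral_const_mul _ (by fun_prop)]
        refine lintegral_congr_ae ?_
        filter_upwards [nu_mem p] with a ha
        have ha0 := ha.1
        have hpa : 0 < p - a := by linarith [ha.2]
        rw [← Finset.mul_prod_erase _ _ (Finset.mem_univ i')]
        rw [Finset.prod_congr rfl (g := fun _ => ENNReal.ofReal a)]
        · rw [Finset.prod_const, Finset.card_erase_of_mem (Finset.mem_univ _), Finset.card_univ,
            Fintype.card_fin, Nat.add_sub_cancel]
          simp only [B, if_true]
          rw [nu_Ici ha, ← ENNReal.ofReal_pow ha0, ← ENNReal.ofReal_mul (by positivity),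
            ← ENNReal.ofReal_mul (by positivity), ← ENNReal.ofReal_mul (by positivity)]
          congr 1
          field_simp
        · intro i hi
          simp only [B, if_neg (Finset.ne_of_mem_erase hi)]
          exact nu_Iic ha
    _ ≤ _ := by
        rw [Finset.sum_const, Finset.sum_const, Finset.card_univ, Finset.card_univ, Fintype.card_fin,
          Fintype.card_fin, nsmul_eq_mul, nsmul_eq_mul,
          ← ENNReal.ofReal_mul (by positivity), ← ENNReal.ofReal_natCast, ← ENNReal.ofReal_natCast,
          ← ENNReal.ofReal_mul (by positivity), ← ENNReal.ofReal_mul (by positivity)]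
        apply ENNReal.ofReal_le_ofReal
        apply le_of_eq
        push_cast
        field_simp
        ring
lemma tangent {p : ℝ} (hp0 : 0 < p) (A c : ℝ) :
    p ^ c * (1 + (-Real.log p) * c) ≤ p ^ A + p ^ c * (-Real.log p) * A := by
  have h1 : p ^ A = p ^ c * p ^ (A - c) := by rw [← Real.rpow_add hp0]; congr 1; ring
  have h2 : 1 + Real.log p * (A - c) ≤ p ^ (A - c) := by
    rw [Real.rpow_def_of_pos hp0]
    have := Real.add_one_le_exp (Real.log p * (A - c)); linarith
  have h3 : 0 < p ^ c := Real.rpow_pos_of_pos hp0 c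
  rw [h1]
  have := mul_le_mul_of_nonneg_left h2 h3.le
  nlinarith

lemma int_bound {N k c : ℕ} {p : ℝ} (hp0 : 0 < p) (hp : p < 1)
    (hc : ((N + 2 : ℕ) : ℝ) + ∑ i ∈ Finset.range k, ((N + 2 : ℕ) : ℝ) / ((N + 2 : ℕ) + i) ≤ c) :
    ENNReal.ofReal (p ^ (N + 2 + c)) ≤
      ∫⁻ x, ENNReal.ofReal (p ^ (p / (p - kthLargest x 2) +
        ∑ i ∈ Finset.range k, (kthLargest x 1 / p) ^ i)) ∂(Measure.pi fun _ : Fin (N+2) => nu p) := by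
  set μ := (Measure.pi fun _ : Fin (N+2) => nu p) with hμ
  set A : (Fin (N+2) → ℝ) → ℝ := fun x => p / (p - kthLargest x 2) +
        ∑ i ∈ Finset.range k, (kthLargest x 1 / p) ^ i with hA
  have hm1 := meas_kth (n := N+2) 1
  have hm2 := meas_kth (n := N+2) 2
  have hAm : Measurable A := by
    refine Measurable.add (by fun_prop) ?_
    exact Finset.measurable_fun_sum _ fun i _ => by fun_prop
  have hl : 0 < -Real.log p := by have := Real.log_neg hp0 hp; linarith
  have hmass : μ univ = ENNReal.ofReal (p ^ (N + 2)) := by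
    rw [hμ, Measure.pi_univ]
    simp [nu, ENNReal.ofReal_pow hp0.le]
  have hIA : ∫⁻ x, ENNReal.ofReal (A x) ∂μ ≤ ENNReal.ofReal (p ^ (N + 2) * c) := by
    calc ∫⁻ x, ENNReal.ofReal (A x) ∂μ ≤ ∫⁻ x, (ENNReal.ofReal (p / (p - kthLargest x 2)) +
          ∑ i ∈ Finset.range k, ENNReal.ofReal ((kthLargest x 1 / p) ^ i)) ∂μ := by
          refine lintegral_mono_ae ?_
          filter_upwards [pi_nu_mem (N+2) p] with x hx
          obtain ⟨-, j, hj⟩ := kth_one_le (by omega) x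
          refine ENNReal.ofReal_add_le.trans ?_
          gcongr
          rw [ENNReal.ofReal_sum_of_nonneg]
          intro i _
          rw [hj]
          exact pow_nonneg (div_nonneg (hx j).1 hp0.le) _
      _ = (∫⁻ x, ENNReal.ofReal (p / (p - kthLargest x 2)) ∂μ) +
          ∑ i ∈ Finset.range k, ∫⁻ x, ENNReal.ofReal ((kthLargest x 1 / p) ^ i) ∂μ := by
          rw [lintegral_add_left (by fun_prop), lintegral_finsetSum']
          intro i _
          exact Measurable.aemeasurable (by fun_prop)
      _ ≤ ENNReal.ofReal (p ^ (N+2) * ((N + 2 : ℕ))) + ∑ i ∈ Finset.range k,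
          ENNReal.ofReal (p ^ (N+2) * ((N + 2 : ℕ) / ((N + 2 : ℕ) + i))) := by
          gcongr with i _
          · exact second_moment hp0
          · exact max_moment (n := N+1) hp0 i
      _ ≤ _ := by
          rw [← ENNReal.ofReal_sum_of_nonneg (fun i _ => by positivity),
            ← ENNReal.ofReal_add (by positivity) (Finset.sum_nonneg fun i _ => by positivity)]
          apply ENNReal.ofReal_le_ofReal
          rw [← Finset.mul_sum, ← mul_add]
          gcongr
  have hpc : 0 < p ^ (c : ℝ) := Real.rpow_pos_of_pos hp0 _
  have key : ∫⁻ _x, ENNReal.ofReal (p ^ (c:ℝ) * (1 + (-Real.log p) * c)) ∂μ ≤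
      ∫⁻ x, (ENNReal.ofReal (p ^ A x) +
        ENNReal.ofReal (p ^ (c:ℝ) * (-Real.log p)) * ENNReal.ofReal (A x)) ∂μ := by
    refine lintegral_mono fun x => ?_
    simp only
    rw [← ENNReal.ofReal_mul (by positivity)]
    exact (ENNReal.ofReal_le_ofReal (tangent hp0 (A x) c)).trans ENNReal.ofReal_add_le
  rw [lintegral_const, hmass, lintegral_add_right _ (by fun_prop),
    lintegral_const_mul _ (by fun_prop)] at key
  have key2 := key.trans (add_le_add_right (mul_le_mul_right hIA _) _)
  rw [← ENNReal.ofReal_mul (by positivity), ← ENNReal.ofReal_mul (by positivity)] at key2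
  have e : p ^ (c:ℝ) * (1 + -Real.log p * ↑c) * p ^ (N + 2) = p ^ (N + 2 + c) +
      p ^ (c:ℝ) * -Real.log p * (p ^ (N + 2) * ↑c) := by
    rw [Real.rpow_natCast, pow_add _ (N+2) c]; ring
  rw [e, ENNReal.ofReal_add (by positivity) (by positivity)] at key2
  exact ENNReal.le_of_add_le_add_right ENNReal.ofReal_ne_top key2

lemma yv_bound {k : ℕ} {t p : ℝ} (h0 : 0 ≤ t) (htp : t ≤ p) (hp : p < 1) :
    ENNReal.ofReal (1 - (1 - p) * ∑ i ∈ Finset.range k, t ^ i) ≤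
    ((Measure.pi fun _ : Fin k => unif).prod unif) {z | pickedY z.1 t z.2 ≤ p} := by
  have hm : MeasurableSet {z : (Fin k → ℝ) × ℝ | pickedY z.1 t z.2 ≤ p} :=
    measurableSet_le ((meas_picked (k := k)).comp (measurable_prodMk_left (x := t))) measurable_const
  have hbad : ((Measure.pi fun _ : Fin k => unif).prod unif) {z | pickedY z.1 t z.2 ≤ p}ᶜ ≤
      ENNReal.ofReal ((1 - p) * ∑ i ∈ Finset.range k, t ^ i) := by
    rw [Measure.prod_apply_symm hm.compl]
    calc _ ≤ ∫⁻ _v, ENNReal.ofReal ((1 - p) * ∑ i ∈ Finset.range k, t ^ i) ∂unif := by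
          refine lintegral_mono fun v => ?_
          have := picked_meas (k := k) v h0 htp hp
          refine le_trans (measure_mono ?_) this
          intro y hy
          simpa using hy
      _ = _ := by simp
  rw [← compl_compl {z : (Fin k → ℝ) × ℝ | pickedY z.1 t z.2 ≤ p}, prob_compl_eq_one_sub hm.compl]
  have hs : 0 ≤ (1 - p) * ∑ i ∈ Finset.range k, t ^ i :=
    mul_nonneg (by linarith) (Finset.sum_nonneg fun i _ => by positivity)
  rw [ENNReal.ofReal_sub _ hs, ENNReal.ofReal_one]
  exact tsub_le_tsub_left hbad 1

instance (n c m : ℕ) : IsProbabilityMeasure (P₁ n c m) := by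
  unfold P₁; infer_instance

lemma XL_bound (n m c : ℕ) (hn : 2 ≤ n) (hm : 1 ≤ m)
    (hcb : (n : ℝ) * (2 + Real.log (1 + (m : ℝ) / (n : ℝ))) ≤ (c : ℝ)) {p : ℝ}
    (hp0 : 0 < p) (hp : p < 1) :
    P₁ n c m {ω : (Fin n → ℝ) × ℝ × (Fin c → ℝ) × (Fin (m - 1) → ℝ) × ℝ |
          p < XL ω.1 ω.2.1 ω.2.2.2.1 ω.2.2.2.2} ≤ 1 - ENNReal.ofReal (p ^ (n + c)) := by
  have hC := const_bound n m c hn hm hcb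
  obtain ⟨N, rfl⟩ : ∃ N, n = N + 2 := ⟨n - 2, by omega⟩
  set k := m - 1
  have hm1 := meas_kth (n := N+2) 1
  have hm2 := meas_kth (n := N+2) 2
  let D : Set (Fin (N+2) → ℝ) := univ.pi (fun _ => Iio p)
  have hD : MeasurableSet D := MeasurableSet.univ_pi fun _ => measurableSet_Iio
  let G : Set ((Fin (N+2) → ℝ) × ℝ × (Fin c → ℝ) × (Fin k → ℝ) × ℝ) :=
    {ω | ω.1 ∈ D} ∩ ({ω | kthLargest ω.1 2 + ω.2.1 * (1 - kthLargest ω.1 2) ≤ p} ∩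
      {ω | pickedY ω.2.2.2.1 (kthLargest ω.1 1) ω.2.2.2.2 ≤ p})
  have hG : MeasurableSet G := by
    refine (measurable_fst hD).inter (MeasurableSet.inter ?_ ?_)
    · refine measurableSet_le ?_ measurable_const
      have : Measurable (fun ω : (Fin (N+2) → ℝ) × ℝ × (Fin c → ℝ) × (Fin k → ℝ) × ℝ =>
        kthLargest ω.1 2) := hm2.comp measurable_fst
      fun_prop
    · refine measurableSet_le ?_ measurable_const
      have h1 : Measurable (fun ω : (Fin (N+2) → ℝ) × ℝ × (Fin c → ℝ) × (Fin k → ℝ) × ℝ =>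
        (kthLargest ω.1 1, ω.2.2.2.1, ω.2.2.2.2)) :=
        (hm1.comp measurable_fst).prodMk (by fun_prop)
      exact meas_picked.comp h1
  have hsub : {ω : (Fin (N+2) → ℝ) × ℝ × (Fin c → ℝ) × (Fin k → ℝ) × ℝ |
          p < XL ω.1 ω.2.1 ω.2.2.2.1 ω.2.2.2.2} ⊆ Gᶜ := by
    rintro ω hω ⟨h1, h2, h3⟩
    obtain ⟨-, j, hj⟩ := kth_one_le (by omega) ω.1
    have h4 : ω.1 j < p := h1 j (mem_univ _)
    simp only [mem_ofPred_eq] at hω h2 h3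
    apply absurd hω
    rw [not_lt]
    unfold XL
    simp only
    split_ifs
    · exact max_le (by rw [hj]; exact h4.le) h2
    · exact max_le h3 h2
  refine (measure_mono hsub).trans ?_
  rw [prob_compl_eq_one_sub hG]
  refine tsub_le_tsub_left ?_ 1
  refine (int_bound (k := k) hp0 hp hC).trans ?_
  have hnu : nu p = unif.restrict (Iio p) := by
    rw [nu, unif, Measure.restrict_restrict measurableSet_Iio]
    congr 1
    ext a; simp only [mem_Ico, mem_inter_iff, mem_Iio, mem_Icc]
    constructor
    · rintro ⟨h, h'⟩; exact ⟨h', h, by linarith⟩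
    · rintro ⟨h, h', _⟩; exact ⟨h', h⟩
  have hpi : (Measure.pi fun _ : Fin (N+2) => nu p) =
      (Measure.pi fun _ : Fin (N+2) => unif).restrict D := by
    rw [hnu]
    exact (Measure.restrict_pi_pi (fun _ : Fin (N+2) => unif) (fun _ => Iio p)).symm
  rw [P₁, Measure.prod_apply hG]
  refine le_trans ?_ (setLIntegral_le_lintegral D _)
  rw [← hpi]
  refine lintegral_mono_ae ?_
  filter_upwards [pi_nu_mem (N+2) p] with x hx
  obtain ⟨-, j, hj⟩ := kth_one_le (by omega) x
  obtain ⟨i2, j2, -, hj2, -⟩ := kth_two (by omega) x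
  have ht := hx j
  rw [← hj] at ht
  have hs := hx j2
  rw [← hj2] at hs
  set t := kthLargest x 1 with htdef
  set s := kthLargest x 2 with hsdef
  have hsec : {u | s + u * (1 - s) ≤ p} ×ˢ ((univ : Set (Fin c → ℝ)) ×ˢ
      {z : (Fin k → ℝ) × ℝ | pickedY z.1 t z.2 ≤ p}) ⊆ Prod.mk x ⁻¹' G := by
    rintro ⟨u, z, y, v⟩ ⟨h1, -, h2⟩
    exact ⟨fun i _ => (hx i).2, h1, h2⟩
  refine le_trans ?_ (measure_mono hsec)
  rw [Measure.prod_prod, Measure.prod_prod, measure_univ, one_mul]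
  have hf := f_bound hp0 hp hs.1 hs.2
  have hR0 : 0 ≤ t / p := div_nonneg ht.1 hp0.le
  have hR1 : t / p ≤ 1 := by rw [div_le_one hp0]; exact ht.2.le
  have hg := (g_bound hp0 hp hR0 hR1 k).2
  rw [mul_div_cancel₀ _ hp0.ne'] at hg
  refine le_trans ?_ (mul_le_mul' (unif_W hs.1 hs.2 hp) (yv_bound (k := k) ht.1 ht.2.le hp))
  rw [Real.rpow_add hp0, ENNReal.ofReal_mul (Real.rpow_nonneg hp0.le _)]
  exact mul_le_mul' (ENNReal.ofReal_le_ofReal hf) (ENNReal.ofReal_le_ofReal hg)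

lemma XS_eq (n m c : ℕ) (hn : 1 ≤ n) (hc : 1 ≤ c) {p : ℝ} (hp0 : 0 ≤ p) (hp : p ≤ 1) :
    P₁ n c m {ω : (Fin n → ℝ) × ℝ × (Fin c → ℝ) × (Fin (m - 1) → ℝ) × ℝ |
          p < max (kthLargest ω.1 1) (kthLargest ω.2.2.1 1)} = 1 - ENNReal.ofReal (p ^ (n + c)) := by
  have hk : ∀ {r : ℕ}, 1 ≤ r → ∀ x : Fin r → ℝ, kthLargest x 1 ≤ p ↔ ∀ i, x i ≤ p := by
    intro r hr x
    obtain ⟨h1, j, hj⟩ := kth_one_le hr x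
    exact ⟨fun h i => (h1 i).trans h, fun h => hj ▸ h j⟩
  let Q : Set ((Fin n → ℝ) × ℝ × (Fin c → ℝ) × (Fin (m - 1) → ℝ) × ℝ) :=
    (univ.pi fun _ => Iic p) ×ˢ ((univ : Set ℝ) ×ˢ ((univ.pi fun _ => Iic p) ×ˢ
      (univ : Set ((Fin (m - 1) → ℝ) × ℝ))))
  have hQ : MeasurableSet Q :=
    (MeasurableSet.univ_pi fun _ => measurableSet_Iic).prod (MeasurableSet.univ.prod
      ((MeasurableSet.univ_pi fun _ => measurableSet_Iic).prod MeasurableSet.univ))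
  have : {ω : (Fin n → ℝ) × ℝ × (Fin c → ℝ) × (Fin (m - 1) → ℝ) × ℝ |
          p < max (kthLargest ω.1 1) (kthLargest ω.2.2.1 1)} = Qᶜ := by
    ext ω
    rw [mem_compl_iff, mem_ofPred_eq, ← not_le, max_le_iff, hk hn, hk hc]
    simp only [Q, mem_prod, mem_univ, mem_pi, mem_Iic, true_and, and_true, forall_true_left]
  rw [this, prob_compl_eq_one_sub hQ]
  congr 1
  simp only [P₁, Q]
  rw [Measure.prod_prod, Measure.prod_prod, Measure.prod_prod, measure_univ, measure_univ,
    Measure.pi_pi, Measure.pi_pi]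
  simp only [unif_Iic hp0 hp, Finset.prod_const, Finset.card_univ, Fintype.card_fin]
  rw [one_mul, mul_one, ENNReal.ofReal_pow hp0, pow_add]

/-- If `n ≥ 2`, `m ≥ 1` and `c ≥ 1` with `c ≥ n(2 + ln(1 + m/n))`, then
`X_S(n,c) = max (X_{(1),n}) (Z_{(1),c})` stochastically dominates `X_L(n,m)`. -/
theorem stmt1 (n m c : ℕ) (hn : 2 ≤ n) (hm : 1 ≤ m) (hc : 1 ≤ c)
    (hcb : (n : ℝ) * (2 + Real.log (1 + (m : ℝ) / (n : ℝ))) ≤ (c : ℝ)) :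
    ∀ p ∈ Set.Icc (0 : ℝ) 1,
      P₁ n c m {ω : (Fin n → ℝ) × ℝ × (Fin c → ℝ) × (Fin (m - 1) → ℝ) × ℝ |
          p < XL ω.1 ω.2.1 ω.2.2.2.1 ω.2.2.2.2} ≤
      P₁ n c m {ω : (Fin n → ℝ) × ℝ × (Fin c → ℝ) × (Fin (m - 1) → ℝ) × ℝ |
          p < max (kthLargest ω.1 1) (kthLargest ω.2.2.1 1)} := by
  rintro p ⟨hp0, hp1⟩
  rw [XS_eq n m c (by omega) hc hp0 hp1]
  rcases hp0.eq_or_lt with rfl | hp0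
  · rw [zero_pow (by omega)]
    simpa using prob_le_one
  rcases hp1.eq_or_lt with rfl | hp1
  · have hlim : Filter.Tendsto (fun r : ℝ => 1 - ENNReal.ofReal (r ^ (n + c)))
        (nhdsWithin 1 (Iio 1)) (nhds (1 - ENNReal.ofReal ((1:ℝ) ^ (n + c)))) := by
      have h1 : Filter.Tendsto (fun r : ℝ => ENNReal.ofReal (r ^ (n + c)))
        (nhds 1) (nhds (ENNReal.ofReal ((1:ℝ) ^ (n + c)))) :=
        (ENNReal.continuous_ofReal.comp (continuous_pow (n + c))).tendsto 1
      exact ENNReal.Tendsto.sub tendsto_const_nhds (h1.mono_left nhdsWithin_le_nhds)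
        (Or.inl ENNReal.one_ne_top)
    refine ge_of_tendsto hlim ?_
    filter_upwards [Ioo_mem_nhdsLT (show (0:ℝ) < 1 by norm_num)] with r hr
    refine le_trans (measure_mono ?_) (XL_bound n m c hn hm hcb hr.1 hr.2)
    intro ω hω
    exact lt_trans hr.2 hω
  · exact XL_bound n m c hn hm hcb hp0 hp1
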